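/- Assume sin(κR) = 0, let m₁ ≠ m₂ be integers with m₁, m₂ ≥ 3, and suppose the constants c_k = ∫_0^R j₀(κr)^k ĵ₀(r) r² dr are nonzero for k = m₁ and k = m₂. Define g : ℝ³ → ℝ by g(x) = j₀(κ‖x‖)^{m₁}/c_{m₁} − j₀(κ‖x‖)^{m₂}/c_{m₂} for ‖x‖ < R and g(x) = 0 for ‖x‖ ≥ R, and define f : ℝ³ → ℝ by f(x) = (Δg)(x) + κ² g(x) for ‖x‖ < R and f(x) = 0 for ‖x‖ ≥ R. Then f is a nonradiating source: for every x with ‖x‖ > R, ∫_{B_R} G(x,y) f(y) dy = 0, where G(x,y) = −(1/(2κ²)) (e^{iκ‖x−y‖} − e^{−κ‖x−y‖})/(4π‖x−y‖). -/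

import Mathlib

open MeasureTheory Real

noncomputable section

abbrev E3 := EuclideanSpace ℝ (Fin 3)

/-- The open ball of radius `R` centered at the origin. -/
def ball3 (R : ℝ) : Set E3 := {x : E3 | ‖x‖ < R}

/-- The Laplacian of a real-valued function: the sum of the second partial derivatives along
coordinate directions. -/
def LapR (w : E3 → ℝ) (x : E3) : ℝ :=
  ∑ i : Fin 3,
    fderiv ℝ (fun z => fderiv ℝ w z (EuclideanSpace.single i (1 : ℝ))) x
      (EuclideanSpace.single i (1 : ℝ))

/-- The Green's function of the biharmonic wave equation in three dimensions. -/
def G3 (κ : ℝ) (x y : E3) : ℂ :=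
  -(1 / (2 * (κ : ℂ) ^ 2)) *
    ((Complex.exp (Complex.I * (κ : ℂ) * (‖x - y‖ : ℂ)) -
        ((Real.exp (-(κ * ‖x - y‖)) : ℝ) : ℂ)) / ((4 * π * ‖x - y‖ : ℝ) : ℂ))

/-- The spherical Bessel function of order zero. -/
def j0 (t : ℝ) : ℝ := if t = 0 then 1 else Real.sin t / t

/-- The modified spherical Bessel function of order zero, with frequency `κ`. -/
def jh0 (κ r : ℝ) : ℝ := if r = 0 then 1 else Real.sinh (κ * r) / (κ * r)

/-- The normalization constants `c_k = ∫_0^R j₀(κr)^k ĵ₀(r) r² dr`. -/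
def cst (κ R : ℝ) (k : ℕ) : ℝ := ∫ r in (0 : ℝ)..R, (j0 (κ * r)) ^ k * jh0 κ r * r ^ 2

lemma hasFDerivAt_norm_aux (y : E3) (hy : y ≠ 0) :
    HasFDerivAt (fun z : E3 => ‖z‖) (‖y‖⁻¹ • innerSL ℝ y) y := by
  have h := (hasStrictFDerivAt_norm_sq y).hasFDerivAt.sqrt (by simpa using hy)
  have e : (fun z : E3 => √(‖z‖ ^ 2)) = fun z => ‖z‖ := by
    ext z; exact Real.sqrt_sq (norm_nonneg _)
  rw [e] at h
  refine h.congr_fderiv ?_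
  ext v
  have : ‖y‖ ≠ 0 := by simpa using hy
  simp [Real.sqrt_sq (norm_nonneg y)]
  field_simp

lemma coord_hasFDerivAt (i : Fin 3) (y : E3) :
    HasFDerivAt (fun z : E3 => z i) (EuclideanSpace.proj i : E3 →L[ℝ] ℝ) y :=
  (EuclideanSpace.proj i : E3 →L[ℝ] ℝ).hasFDerivAt

lemma lapR_radial (φ φ1 φ2 : ℝ → ℝ) (h1 : ∀ r, HasDerivAt φ (φ1 r) r)
    (h2 : ∀ r, HasDerivAt φ1 (φ2 r) r) (w : E3 → ℝ) (y : E3) (hy : y ≠ 0)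
    (hw : w =ᶠ[nhds y] fun z => φ ‖z‖) :
    LapR w y = φ2 ‖y‖ + 2 * (φ1 ‖y‖ / ‖y‖) := by
  have hn : ‖y‖ ≠ 0 := by simpa using hy
  have hsum : ∑ i, y i ^ 2 = ‖y‖ ^ 2 := by
    rw [EuclideanSpace.norm_sq_eq]; simp
  have key : ∀ i : Fin 3, fderiv ℝ (fun z => fderiv ℝ w z (EuclideanSpace.single i (1 : ℝ))) y
      (EuclideanSpace.single i (1 : ℝ)) =
      φ2 ‖y‖ * (y i ^ 2 / ‖y‖ ^ 2) + φ1 ‖y‖ * (1 / ‖y‖ - y i ^ 2 / ‖y‖ ^ 3) := by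
    intro i
    have e1 : (fun z => fderiv ℝ w z (EuclideanSpace.single i (1 : ℝ))) =ᶠ[nhds y]
        fun z => φ1 ‖z‖ * (z i * ‖z‖⁻¹) := by
      filter_upwards [hw.eventually_nhds, isOpen_ne.mem_nhds hy] with z hz hz0
      have hz0' : z ≠ 0 := hz0
      rw [Filter.EventuallyEq.fderiv_eq hz]
      have := (h1 ‖z‖).comp_hasFDerivAt z (hasFDerivAt_norm_aux z hz0')
      have e2 := this.fderiv
      simp only [Function.comp_def] at e2
      rw [e2]
      simp [EuclideanSpace.inner_single_right]
      left; ring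
    rw [e1.fderiv_eq]
    have hN := hasFDerivAt_norm_aux y hy
    have hd := ((h2 ‖y‖).comp_hasFDerivAt y hN).mul ((coord_hasFDerivAt i y).mul
      ((hasDerivAt_inv hn).comp_hasFDerivAt y hN))
    have e2 := hd.fderiv
    simp only [Function.comp_def, Pi.mul_def] at e2
    rw [e2]
    simp [EuclideanSpace.inner_single_right]
    field_simp
    ring
  unfold LapR
  simp_rw [key]
  rw [Finset.sum_add_distrib, ← Finset.mul_sum, ← Finset.mul_sum, Finset.sum_sub_distrib,
    ← Finset.sum_div, ← Finset.sum_div, ← Finset.sum_div, hsum]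
  simp only [Finset.sum_const, Finset.card_univ, Fintype.card_fin, nsmul_eq_mul]
  field_simp
  ring

lemma j0_eq : j0 = Real.sinc := rfl

lemma contDiff_j0 : ContDiff ℝ 2 j0 := by
  rw [j0_eq, contDiff_iff_contDiffAt]
  intro x
  by_cases hx : x = 0
  · subst hx
    rw [Real.sinc_eq_dslope]
    obtain ⟨p, hp⟩ : AnalyticAt ℝ Real.sin 0 := Real.analyticAt_sin
    exact (HasFPowerSeriesAt.has_fpower_series_dslope_fslope hp).analyticAt.contDiffAt
  · have : Real.sinc =ᶠ[nhds x] fun t => Real.sin t / t := by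
      filter_upwards [isOpen_ne.mem_nhds hx] with t ht
      exact Real.sinc_of_ne_zero ht
    refine ContDiffAt.congr_of_eventuallyEq ?_ this
    exact (Real.contDiff_sin.contDiffAt).div contDiffAt_id hx

lemma final_1d (κ R : ℝ) (hRzero : Real.sin (κ * R) = 0)
    (φ φ1 φ2 F : ℝ → ℝ) (h1 : ∀ r, HasDerivAt φ (φ1 r) r)
    (h2 : ∀ r, HasDerivAt φ1 (φ2 r) r) (hc : Continuous φ2)
    (hF : ∀ r, r * F r = r * φ2 r + 2 * φ1 r + κ ^ 2 * (r * φ r))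
    (hR0 : φ R = 0) (hR1 : φ1 R = 0)
    (hint : ∫ r in (0:ℝ)..R, φ r * (r * Real.sinh (κ * r)) = 0) :
    (∫ r in (0:ℝ)..R, r * F r * Real.sin (κ * r)) = 0 ∧
    (∫ r in (0:ℝ)..R, r * F r * Real.sinh (κ * r)) = 0 := by
  have c0 : Continuous φ := continuous_iff_continuousAt.2 fun r => (h1 r).continuousAt
  have c1 : Continuous φ1 := continuous_iff_continuousAt.2 fun r => (h2 r).continuousAt
  simp_rw [hF]
  have hl : ∀ r : ℝ, HasDerivAt (fun r => κ * r) κ r := fun r => by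
    simpa using (hasDerivAt_id r).const_mul κ
  have hu : ∀ r, HasDerivAt (fun r => r * φ r) (φ r + r * φ1 r) r := fun r => by
    refine ((hasDerivAt_id r).mul (h1 r)).congr_deriv ?_
    simp
  have hu1 : ∀ r, HasDerivAt (fun r => φ r + r * φ1 r) (r * φ2 r + 2 * φ1 r) r := fun r => by
    have := (h1 r).add ((hasDerivAt_id r).mul (h2 r))
    refine this.congr_deriv ?_
    simp; ring
  constructor
  · have hd : ∀ r, HasDerivAt (fun r => (φ r + r * φ1 r) * Real.sin (κ * r)
        - κ * ((r * φ r) * Real.cos (κ * r)))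
        ((r * φ2 r + 2 * φ1 r + κ ^ 2 * (r * φ r)) * Real.sin (κ * r)) r := fun r => by
      have := ((hu1 r).mul (hl r).sin).sub (((hu r).mul (hl r).cos).const_mul κ)
      refine this.congr_deriv ?_
      ring
    rw [intervalIntegral.integral_eq_sub_of_hasDerivAt (fun r _ => hd r)
      (Continuous.intervalIntegrable (by fun_prop) _ _)]
    simp [hRzero, hR0]
  · have hd : ∀ r, HasDerivAt (fun r => (φ r + r * φ1 r) * Real.sinh (κ * r)
        - κ * ((r * φ r) * Real.cosh (κ * r)))
        ((r * φ2 r + 2 * φ1 r - κ ^ 2 * (r * φ r)) * Real.sinh (κ * r)) r := fun r => by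
      have := ((hu1 r).mul (hl r).sinh).sub (((hu r).mul (hl r).cosh).const_mul κ)
      refine this.congr_deriv ?_
      ring
    have e : ∀ r, (r * φ2 r + 2 * φ1 r + κ ^ 2 * (r * φ r)) * Real.sinh (κ * r)
      = (r * φ2 r + 2 * φ1 r - κ ^ 2 * (r * φ r)) * Real.sinh (κ * r)
        + 2 * κ ^ 2 * (φ r * (r * Real.sinh (κ * r))) := fun r => by ring
    simp_rw [e]
    rw [intervalIntegral.integral_add (Continuous.intervalIntegrable (by fun_prop) _ _)
      (Continuous.intervalIntegrable (by fun_prop) _ _), intervalIntegral.integral_const_mul, hint,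
      intervalIntegral.integral_eq_sub_of_hasDerivAt (fun r _ => hd r)
      (Continuous.intervalIntegrable (by fun_prop) _ _)]
    simp [hR0, hR1]


lemma radial_change (z : ℝ) (h : ℝ → ℂ) :
    ∫ ρ in Set.Ioi (0:ℝ), ρ • h (√(z ^ 2 + ρ ^ 2)) = ∫ r in Set.Ioi |z|, r • h r := by
  have him : (fun ρ : ℝ => √(z ^ 2 + ρ ^ 2)) '' Set.Ioi 0 = Set.Ioi |z| := by
    ext r
    simp only [Set.mem_image, Set.mem_Ioi]
    constructor
    · rintro ⟨ρ, hρ, rfl⟩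
      rw [← Real.sqrt_sq_eq_abs]
      exact Real.sqrt_lt_sqrt (sq_nonneg _) (by nlinarith)
    · intro hr
      have h0 := abs_nonneg z
      have : z ^ 2 < r ^ 2 := by rw [← sq_abs z]; nlinarith
      refine ⟨√(r ^ 2 - z ^ 2), Real.sqrt_pos.2 (by linarith), ?_⟩
      rw [Real.sq_sqrt (by linarith)]
      rw [show z ^ 2 + (r ^ 2 - z ^ 2) = r ^ 2 by ring, Real.sqrt_sq (by linarith)]
  rw [← him, integral_image_eq_integral_abs_deriv_smul (f' := fun ρ => ρ / √(z ^ 2 + ρ ^ 2))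
    measurableSet_Ioi]
  · refine setIntegral_congr_fun measurableSet_Ioi fun ρ hρ => ?_
    have hρ' : (0:ℝ) < ρ := hρ
    have hs : 0 < √(z ^ 2 + ρ ^ 2) := Real.sqrt_pos.2 (by positivity)
    rw [abs_of_pos (by positivity), smul_smul]
    congr 1
    field_simp
  · intro ρ hρ
    have hρ' : (0:ℝ) < ρ := hρ
    have := (((hasDerivAt_id ρ).pow 2).const_add (z ^ 2)).sqrt (by simp; positivity)
    refine (HasDerivAt.hasDerivWithinAt ?_)
    refine this.congr_deriv ?_
    simp
    field_simp
  · intro a ha b hb hab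
    have ha' : (0:ℝ) < a := ha
    have hb' : (0:ℝ) < b := hb
    rw [Real.sqrt_inj (by positivity) (by positivity)] at hab
    nlinarith

lemma integrable_of_bdd {α : Type*} [MeasurableSpace α] (μ : Measure α) (s : Set α)
    (hμ : μ s < ⊤) (f : α → ℂ) (hf : Measurable f) (C : ℝ) (hC : ∀ x, ‖f x‖ ≤ C)
    (h0 : ∀ x, x ∉ s → f x = 0) : Integrable f μ := by
  have : Integrable f (μ.restrict s) :=
    Measure.integrableOn_of_bounded (M := C) hμ.ne hf.aestronglyMeasurable
      (Filter.Eventually.of_forall hC)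
  rw [← integrableOn_univ]
  exact (integrableOn_iff_integrable_of_support_subset (f := f) (s := s) (by
    intro x hx; by_contra h; exact hx (h0 x h))).1 this |>.integrableOn

lemma integral_radial_axial (e : E3) (he : ‖e‖ = 1) (W : ℝ → ℝ → ℂ)
    (hW : Measurable (Function.uncurry W)) (C R : ℝ) (hC : ∀ r z, ‖W r z‖ ≤ C)
    (hs : ∀ r z, R ≤ r → W r z = 0) :
    ∃ c : ℝ, ∫ y : E3, W ‖y‖ (inner ℝ e y) =
      c • ∫ r in Set.Ioi (0:ℝ), ∫ z in Set.Ioo (-r) r, r • W r z := by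
  obtain ⟨b, hb⟩ : ∃ b : OrthonormalBasis (Fin 3) ℝ E3, b 0 = e := by
    obtain ⟨b, hb⟩ := Orthonormal.exists_orthonormalBasis_extension_of_card_eq (𝕜 := ℝ) (E := E3)
      (ι := Fin 3) (by simp) (v := fun _ => e) (s := {0}) (by
        rw [orthonormal_iff_ite]
        rintro ⟨i, hi⟩ ⟨j, hj⟩
        have hi' : i = 0 := hi
        have hj' : j = 0 := hj
        subst hi' hj'
        simp [he])
    exact ⟨b, hb 0 rfl⟩
  have mp := (volume_preserving_piFinSuccAbove (fun _ : Fin 3 => ℝ) 0).comp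
    ((PiLp.volume_preserving_ofLp (Fin 3)).comp b.measurePreserving_repr)
  have hnorm : ∀ y : E3, ‖y‖ = √((b.repr y 0) ^ 2 +
      ‖(WithLp.toLp 2 (fun i : Fin 2 => b.repr y i.succ) : EuclideanSpace ℝ (Fin 2))‖ ^ 2) := by
    intro y
    rw [← b.repr.norm_map y, EuclideanSpace.norm_eq, EuclideanSpace.norm_sq_eq,
      Fin.sum_univ_succ]
    simp
  let T : ℝ × (Fin 2 → ℝ) → ℂ := fun p =>
    W (√(p.1 ^ 2 + ‖(WithLp.toLp 2 p.2 : EuclideanSpace ℝ (Fin 2))‖ ^ 2)) p.1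
  have hTm : Measurable T := by
    refine hW.comp (f := fun p : ℝ × (Fin 2 → ℝ) =>
      ((√(p.1 ^ 2 + ‖(WithLp.toLp 2 p.2 : EuclideanSpace ℝ (Fin 2))‖ ^ 2)), p.1)) ?_
    refine Continuous.measurable ?_
    fun_prop
  have hTi : Integrable T := by
    refine integrable_of_bdd _ (Set.Icc (-|R|) |R| ×ˢ Set.Icc (fun _ => -|R|) (fun _ => |R|)) ?_ T hTm C (fun _ => hC _ _) ?_
    · exact (isCompact_Icc.prod isCompact_Icc).measure_lt_top
    · rintro ⟨z, w⟩ hp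
      refine hs _ _ ?_
      by_contra! hlt
      apply hp
      have hsq : z ^ 2 + ‖(WithLp.toLp 2 w : EuclideanSpace ℝ (Fin 2))‖ ^ 2 ≤ R ^ 2 := by
        have := Real.sqrt_nonneg (z ^ 2 + ‖(WithLp.toLp 2 w : EuclideanSpace ℝ (Fin 2))‖ ^ 2)
        exact (Real.sqrt_le_left (by linarith)).1 hlt.le
      rw [EuclideanSpace.norm_sq_eq] at hsq
      simp only [Fin.sum_univ_two, Real.norm_eq_abs, sq_abs] at hsq
      have hz : |z| ≤ |R| := sq_le_sq.1 (by nlinarith)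
      have hw0 : |w 0| ≤ |R| := sq_le_sq.1 (by nlinarith)
      have hw1 : |w 1| ≤ |R| := sq_le_sq.1 (by nlinarith)
      refine ⟨abs_le.1 hz, fun i => ?_, fun i => ?_⟩
      · fin_cases i
        · exact (abs_le.1 hw0).1
        · exact (abs_le.1 hw1).1
      · fin_cases i
        · exact (abs_le.1 hw0).2
        · exact (abs_le.1 hw1).2
  have step1 : ∫ y : E3, W ‖y‖ (inner ℝ e y) = ∫ p, T p := by
    rw [← mp.map_eq, integral_map mp.measurable.aemeasurable (by
      exact hTm.aestronglyMeasurable)]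
    congr 1
    ext y
    rw [hnorm y, ← hb, ← b.repr_apply_apply]
    rfl
  have step2 : ∀ z : ℝ, ∫ w : Fin 2 → ℝ, T (z, w) =
      (2 * (volume : Measure (EuclideanSpace ℝ (Fin 2))).real (Metric.ball 0 1)) •
        ∫ r in Set.Ioi |z|, r • W r z := by
    intro z
    have := (PiLp.volume_preserving_toLp (Fin 2)).integral_comp
      (MeasurableEquiv.toLp 2 (Fin 2 → ℝ)).measurableEmbedding
      (fun v : EuclideanSpace ℝ (Fin 2) => W (√(z ^ 2 + ‖v‖ ^ 2)) z)
    simp only [T]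
    rw [this, integral_fun_norm_addHaar volume (fun t => W (√(z ^ 2 + t ^ 2)) z),
      ← radial_change z (fun r => W r z)]
    simp [mul_smul, two_smul]
  refine ⟨2 * (volume : Measure (EuclideanSpace ℝ (Fin 2))).real (Metric.ball 0 1), ?_⟩
  rw [step1, show (volume : Measure (ℝ × (Fin 2 → ℝ))) = volume.prod volume from rfl,
    integral_prod _ hTi]
  simp_rw [step2]
  rw [integral_smul]
  congr 1
  let S : ℝ → ℝ → ℂ := fun z r => ({p : ℝ × ℝ | |p.1| < p.2}.indicator
    (fun p => p.2 • W p.2 p.1)) (z, r)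
  have hset : MeasurableSet {p : ℝ × ℝ | |p.1| < p.2} :=
    measurableSet_lt (by fun_prop) (by fun_prop)
  have hSm : Measurable (Function.uncurry S) := by
    have : Measurable fun p : ℝ × ℝ => p.2 • W p.2 p.1 :=
      measurable_snd.smul (hW.comp (f := fun p : ℝ × ℝ => (p.2, p.1)) measurable_swap)
    exact this.indicator hset
  have hC0 : 0 ≤ C := (norm_nonneg _).trans (hC 0 0)
  have hSi : Integrable (Function.uncurry S) (volume.prod volume) := by
    refine integrable_of_bdd _ (Set.Icc (-|R|) |R| ×ˢ Set.Icc 0 |R|) ?_ _ hSm (|R| * C) ?_ ?_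
    · exact (isCompact_Icc.prod isCompact_Icc).measure_lt_top
    · rintro ⟨z, r⟩
      simp only [Function.uncurry, S, Set.indicator, Set.mem_ofPred_eq]
      split_ifs with h
      · have := abs_nonneg z
        by_cases hr : R ≤ r
        · rw [hs _ _ hr]; simp; positivity
        · rw [norm_smul, Real.norm_eq_abs, abs_of_pos (by linarith)]
          have := le_abs_self R
          exact mul_le_mul (by linarith) (hC _ _) (norm_nonneg _) (abs_nonneg _)
      · simp; positivity
    · rintro ⟨z, r⟩ hp
      simp only [Function.uncurry, S, Set.indicator, Set.mem_ofPred_eq]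
      split_ifs with h
      · rw [hs, smul_zero]
        by_contra! hlt
        have := abs_nonneg z
        have h2 := le_abs_self R
        exact hp ⟨abs_le.1 (by linarith), ⟨by linarith, by linarith⟩⟩
      · rfl
  have hL : ∀ z : ℝ, ∫ r in Set.Ioi |z|, r • W r z = ∫ r, S z r := by
    intro z
    rw [← integral_indicator measurableSet_Ioi]
    rfl
  have hR' : ∫ r in Set.Ioi (0:ℝ), ∫ z in Set.Ioo (-r) r, r • W r z = ∫ r, ∫ z, S z r := by
    rw [← integral_indicator measurableSet_Ioi]
    congr 1
    ext r
    by_cases hr : 0 < r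
    · rw [Set.indicator_of_mem (show r ∈ Set.Ioi 0 from hr), ← integral_indicator measurableSet_Ioo]
      congr 1
      ext z
      simp only [S, Set.indicator, Set.mem_ofPred_eq, Set.mem_Ioo, abs_lt]
    · rw [Set.indicator_of_notMem (show r ∉ Set.Ioi 0 from hr)]
      symm
      convert integral_zero ℝ ℂ with z
      simp only [S, Set.indicator, Set.mem_ofPred_eq]
      rw [if_neg]
      have := abs_nonneg z
      linarith
  simp_rw [hL]
  rw [hR', integral_integral_swap hSi]

/-- The radial profile of the Green's function. -/
def qker (κ s : ℝ) : ℂ :=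
  -(1 / (2 * (κ : ℂ) ^ 2)) *
    ((Complex.exp (Complex.I * (κ : ℂ) * (s : ℂ)) -
        ((Real.exp (-(κ * s)) : ℝ) : ℂ)) / ((4 * π * s : ℝ) : ℂ))

/-- An antiderivative of `s * qker κ s`. -/
def qprim (κ s : ℝ) : ℂ :=
  -(1 / (2 * (κ : ℂ) ^ 2)) * (1 / ((4 * π : ℝ) : ℂ)) *
    (Complex.exp (Complex.I * (κ : ℂ) * (s : ℂ)) / (Complex.I * κ) +
        Complex.exp (-(κ * s : ℂ)) / κ)

lemma qprim_deriv (κ s : ℝ) (hκ : 0 < κ) (hs : 0 < s) :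
    HasDerivAt (qprim κ) (s * qker κ s) s := by
  have hκ' : (κ : ℂ) ≠ 0 := by exact_mod_cast hκ.ne'
  have hs' : (s : ℂ) ≠ 0 := by exact_mod_cast hs.ne'
  have hpi : (π : ℂ) ≠ 0 := by exact_mod_cast Real.pi_ne_zero
  have h0 : HasDerivAt (fun s : ℝ => (s : ℂ)) 1 s := Complex.ofRealCLM.hasDerivAt
  have e1 := ((h0.const_mul (Complex.I * (κ : ℂ))).cexp).div_const (Complex.I * κ)
  have e2 := ((h0.const_mul (κ : ℂ)).neg.cexp).div_const (κ : ℂ)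
  have := (e1.add e2).const_mul (-(1 / (2 * (κ : ℂ) ^ 2)) * (1 / ((4 * π : ℝ) : ℂ)))
  refine this.congr_deriv ?_
  have hI := Complex.I_ne_zero
  simp only [qker]
  push_cast
  simp only [Pi.neg_apply]
  field_simp
  ring

lemma qprim_diff (κ a : ℝ) (hκ : 0 < κ) : ∃ α β : ℂ, ∀ r : ℝ,
    qprim κ (a + r) - qprim κ (a - r) = α * (Real.sin (κ * r) : ℝ) + β * (Real.sinh (κ * r) : ℝ) := by
  have hκ' : (κ : ℂ) ≠ 0 := by exact_mod_cast hκ.ne'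
  have hI := Complex.I_ne_zero
  refine ⟨-(1 / (2 * (κ : ℂ) ^ 2)) * (1 / ((4 * π : ℝ) : ℂ)) *
    (Complex.exp (Complex.I * κ * a) * 2 / κ), -(1 / (2 * (κ : ℂ) ^ 2)) * (1 / ((4 * π : ℝ) : ℂ)) *
    (- Complex.exp (-(κ * a)) * 2 / κ), fun r => ?_⟩
  have h1 : Complex.exp (Complex.I * κ * ((a + r : ℝ) : ℂ)) =
      Complex.exp (Complex.I * κ * a) * Complex.exp ((κ * r : ℂ) * Complex.I) := by
    rw [← Complex.exp_add]; congr 1; push_cast; ring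
  have h2 : Complex.exp (Complex.I * κ * ((a - r : ℝ) : ℂ)) =
      Complex.exp (Complex.I * κ * a) * Complex.exp (-(κ * r : ℂ) * Complex.I) := by
    rw [← Complex.exp_add]; congr 1; push_cast; ring
  have h3 : Complex.exp (-(κ * ((a + r : ℝ) : ℂ))) =
      Complex.exp (-(κ * a)) * Complex.exp (-(κ * r : ℂ)) := by
    rw [← Complex.exp_add]; congr 1; push_cast; ring
  have h4 : Complex.exp (-(κ * ((a - r : ℝ) : ℂ))) =
      Complex.exp (-(κ * a)) * Complex.exp ((κ * r : ℂ)) := by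
    rw [← Complex.exp_add]; congr 1; push_cast; ring
  unfold qprim
  rw [h1, h2, h3, h4]
  push_cast
  have hI2 : ∀ w : ℂ, w / (Complex.I * κ) = -(Complex.I * w) / κ := by
    intro w
    rw [div_eq_div_iff (mul_ne_zero hI hκ') hκ']
    linear_combination w * κ * Complex.I_mul_I
  rw [Complex.sin, Complex.sinh, hI2, hI2]
  ring

lemma inner_int (κ a r : ℝ) (hκ : 0 < κ) (hr : 0 < r) (hra : r < a) :
    ∫ z in (-r)..r, qker κ (√(r ^ 2 - 2 * a * z + a ^ 2)) =
      (1 / (a : ℂ)) * (qprim κ (a + r) - qprim κ (a - r)) := by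
  have ha : 0 < a := hr.trans hra
  have ha' : (a : ℂ) ≠ 0 := by exact_mod_cast ha.ne'
  have hpos : ∀ z ∈ Set.uIcc (-r) r, 0 < r ^ 2 - 2 * a * z + a ^ 2 := by
    intro z hz
    rw [Set.uIcc_of_le (by linarith)] at hz
    nlinarith [hz.1, hz.2, mul_pos (sub_pos.2 hra) (sub_pos.2 hra),
      mul_nonneg ha.le (sub_nonneg.2 hz.2)]
  have hd : ∀ z ∈ Set.uIcc (-r) r, HasDerivAt
      (fun z => -(1 / (a : ℂ)) * qprim κ (√(r ^ 2 - 2 * a * z + a ^ 2)))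
      (qker κ (√(r ^ 2 - 2 * a * z + a ^ 2))) z := by
    intro z hz
    have hp := hpos z hz
    have hs : 0 < √(r ^ 2 - 2 * a * z + a ^ 2) := Real.sqrt_pos.2 hp
    have hin : HasDerivAt (fun z => √(r ^ 2 - 2 * a * z + a ^ 2))
        (-(a / √(r ^ 2 - 2 * a * z + a ^ 2))) z := by
      have := ((((hasDerivAt_id z).const_mul (2 * a)).const_sub (r ^ 2)).add_const (a ^ 2)).sqrt
        hp.ne'
      refine this.congr_deriv ?_
      simp only [id]
      field_simp
    have := ((qprim_deriv κ _ hκ hs).scomp z hin).const_mul (-(1 / (a : ℂ)))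
    refine this.congr_deriv ?_
    have hs' : ((√(r ^ 2 - 2 * a * z + a ^ 2) : ℝ) : ℂ) ≠ 0 := by exact_mod_cast hs.ne'
    rw [Complex.real_smul]
    push_cast
    field_simp
  have hcont : ContinuousOn (fun z => qker κ (√(r ^ 2 - 2 * a * z + a ^ 2))) (Set.uIcc (-r) r) := by
    unfold qker
    refine ContinuousOn.mul continuousOn_const (ContinuousOn.div ?_ ?_ ?_)
    · fun_prop
    · fun_prop
    · intro z hz
      have hs : 0 < √(r ^ 2 - 2 * a * z + a ^ 2) := Real.sqrt_pos.2 (hpos z hz)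
      have := Real.pi_pos
      exact_mod_cast (by positivity : 4 * π * √(r ^ 2 - 2 * a * z + a ^ 2) ≠ 0)
  rw [intervalIntegral.integral_eq_sub_of_hasDerivAt hd hcont.intervalIntegrable]
  rw [show r ^ 2 - 2 * a * r + a ^ 2 = (a - r) ^ 2 by ring,
    show r ^ 2 - 2 * a * -r + a ^ 2 = (a + r) ^ 2 by ring,
    Real.sqrt_sq (by linarith), Real.sqrt_sq (by linarith)]
  ring

lemma main_int (κ R : ℝ) (hκ : 0 < κ) (hR : 0 < R) (F : ℝ → ℝ) (hF : Continuous F)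
    (hsin : (∫ r in (0:ℝ)..R, r * F r * Real.sin (κ * r)) = 0)
    (hsinh : (∫ r in (0:ℝ)..R, r * F r * Real.sinh (κ * r)) = 0)
    (x : E3) (hx : R < ‖x‖) :
    (∫ y in ball3 R, G3 κ x y * ((F ‖y‖ : ℝ) : ℂ)) = 0 := by
  classical
  set a := ‖x‖ with ha_def
  have ha : 0 < a := hR.trans hx
  let S : Set (ℝ × ℝ) := {p | p.1 < R ∧ |p.2| ≤ p.1}
  have hS : MeasurableSet S :=
    (measurableSet_lt (f := fun p : ℝ × ℝ => p.1) (g := fun _ => R)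
      (by fun_prop) (by fun_prop)).inter
      (measurableSet_le (f := fun p : ℝ × ℝ => |p.2|) (g := fun p : ℝ × ℝ => p.1)
      (by fun_prop) (by fun_prop))
  let W : ℝ → ℝ → ℂ := fun r z =>
    S.indicator (fun p => qker κ (√(p.1 ^ 2 - 2 * a * p.2 + a ^ 2)) * ((F p.1 : ℝ) : ℂ)) (r, z)
  have hqm : Measurable (qker κ) := by
    unfold qker
    refine Measurable.mul measurable_const (Measurable.div ?_ ?_)
    · exact Continuous.measurable (by fun_prop)
    · exact Continuous.measurable (by fun_prop)
  have hW : Measurable (Function.uncurry W) := by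
    have : Measurable (fun p : ℝ × ℝ => qker κ (√(p.1 ^ 2 - 2 * a * p.2 + a ^ 2)) *
        ((F p.1 : ℝ) : ℂ)) := by
      refine Measurable.mul (hqm.comp (Continuous.measurable (by fun_prop))) ?_
      exact Continuous.measurable (by fun_prop)
    exact this.indicator hS
  obtain ⟨C, hC⟩ : ∃ C, ∀ p ∈ Set.Icc (a - R) (a + R) ×ˢ Set.Icc 0 R,
      ‖qker κ p.1 * ((F p.2 : ℝ) : ℂ)‖ ≤ C := by
    refine IsCompact.exists_bound_of_continuousOn (isCompact_Icc.prod isCompact_Icc) ?_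
    unfold qker
    refine ContinuousOn.mul (ContinuousOn.mul continuousOn_const (ContinuousOn.div ?_ ?_ ?_)) ?_
    · fun_prop
    · fun_prop
    · rintro ⟨s, r⟩ ⟨hs, -⟩
      have hs0 : 0 < s := by have := hs.1; simp only at this; linarith
      have := Real.pi_pos
      exact_mod_cast (by positivity : 4 * π * s ≠ 0)
    · fun_prop
  have hbd : ∀ r z, ‖W r z‖ ≤ max C 0 := by
    intro r z
    by_cases h : (r, z) ∈ S
    · simp only [W, Set.indicator_of_mem h]
      obtain ⟨h1, h2⟩ := h
      simp only at h1 h2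
      have h0 := abs_nonneg z
      obtain ⟨h3, h4⟩ := abs_le.1 h2
      refine (hC (_, r) ⟨⟨?_, ?_⟩, ⟨by linarith, h1.le⟩⟩).trans (le_max_left _ _)
      · refine Real.le_sqrt_of_sq_le ?_
        nlinarith [mul_nonneg ha.le (sub_nonneg.2 h4)]
      · refine Real.sqrt_le_iff.2 ⟨by linarith, ?_⟩
        nlinarith [mul_nonneg ha.le (sub_nonneg.2 h3)]
    · simp only [W, Set.indicator_of_notMem h]
      simp
  have hzero : ∀ r z, R ≤ r → W r z = 0 := by
    intro r z hr
    exact Set.indicator_of_notMem (fun h => absurd h.1 (not_lt.2 hr)) _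
  obtain ⟨c, hc⟩ := integral_radial_axial (a⁻¹ • x) (by
    rw [norm_smul, Real.norm_eq_abs, abs_of_pos (by positivity), ← ha_def]; field_simp)
    W hW (max C 0) R hbd hzero
  have hLHS : (∫ y in ball3 R, G3 κ x y * ((F ‖y‖ : ℝ) : ℂ)) =
      ∫ y : E3, W ‖y‖ (inner ℝ (a⁻¹ • x) y) := by
    have hm : MeasurableSet (ball3 R) := measurableSet_lt (by fun_prop) (by fun_prop)
    rw [← integral_indicator hm]
    congr 1
    ext y
    by_cases hy : ‖y‖ < R
    · rw [Set.indicator_of_mem (show y ∈ ball3 R from hy)]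
      have hmem : (‖y‖, inner ℝ (a⁻¹ • x) y) ∈ S := by
        refine ⟨hy, (abs_real_inner_le_norm _ _).trans ?_⟩
        rw [norm_smul, Real.norm_eq_abs, abs_of_pos (by positivity), ← ha_def]
        simp [ha.ne']
      simp only [W]
      rw [Set.indicator_of_mem hmem]
      have hn : ‖x - y‖ = √(‖y‖ ^ 2 - 2 * a * inner ℝ (a⁻¹ • x) y + a ^ 2) := by
        rw [← Real.sqrt_sq (norm_nonneg (x - y)), norm_sub_sq_real, real_inner_smul_left]
        congr 1
        field_simp
        ring
      simp only
      rw [← hn]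
      rfl
    · rw [Set.indicator_of_notMem (show y ∉ ball3 R from hy), hzero _ _ (not_lt.1 hy)]
  rw [hLHS, hc]
  obtain ⟨α, β, hαβ⟩ := qprim_diff κ a hκ
  have hinner : ∀ r ∈ Set.Ioi (0:ℝ), ∫ z in Set.Ioo (-r) r, r • W r z =
      (Set.Iio R).indicator (fun r => (α / a) * ((r * F r * Real.sin (κ * r) : ℝ) : ℂ) +
        (β / a) * ((r * F r * Real.sinh (κ * r) : ℝ) : ℂ)) r := by
    intro r hr
    have hr0 : 0 < r := hr
    by_cases hrR : r < R
    · rw [Set.indicator_of_mem (show r ∈ Set.Iio R from hrR)]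
      have e : ∀ z ∈ Set.Ioo (-r) r, r • W r z =
          ((r * F r : ℝ) : ℂ) * qker κ (√(r ^ 2 - 2 * a * z + a ^ 2)) := by
        intro z hz
        have hmem : (r, z) ∈ S := ⟨hrR, (abs_lt.2 hz).le⟩
        simp only [W]
        rw [Set.indicator_of_mem hmem, Complex.real_smul]
        push_cast
        ring
      rw [setIntegral_congr_fun measurableSet_Ioo e, ← integral_Ioc_eq_integral_Ioo,
        ← intervalIntegral.integral_of_le (by linarith), intervalIntegral.integral_const_mul,
        inner_int κ a r hκ hr0 (hrR.trans hx), hαβ r]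
      push_cast
      ring
    · rw [Set.indicator_of_notMem (show r ∉ Set.Iio R from hrR)]
      simp [hzero r _ (not_lt.1 hrR)]
  rw [setIntegral_congr_fun measurableSet_Ioi hinner, setIntegral_indicator measurableSet_Iio,
    Set.Ioi_inter_Iio, ← integral_Ioc_eq_integral_Ioo, ← intervalIntegral.integral_of_le hR.le,
    intervalIntegral.integral_add (Continuous.intervalIntegrable (by fun_prop) _ _)
      (Continuous.intervalIntegrable (by fun_prop) _ _),
    intervalIntegral.integral_const_mul, intervalIntegral.integral_const_mul,
    intervalIntegral.integral_ofReal, intervalIntegral.integral_ofReal, hsin, hsinh]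
  simp

lemma cst_eq (κ R : ℝ) (hκ : 0 < κ) (k : ℕ) :
    cst κ R k = ∫ r in (0:ℝ)..R, κ⁻¹ * (j0 (κ * r) ^ k * (r * Real.sinh (κ * r))) := by
  unfold cst
  congr 1
  ext r
  by_cases hr : r = 0
  · simp [hr]
  · simp only [jh0, hr, if_false]
    field_simp

theorem explicit_nonradiating_source
    (κ R : ℝ) (hκ : 0 < κ) (hR : 0 < R) (hRzero : Real.sin (κ * R) = 0)
    (m₁ m₂ : ℕ) (hm₁ : 3 ≤ m₁) (hm₂ : 3 ≤ m₂) (hne : m₁ ≠ m₂)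
    (hc₁ : cst κ R m₁ ≠ 0) (hc₂ : cst κ R m₂ ≠ 0)
    (g : E3 → ℝ)
    (hg : ∀ x : E3,
      g x = if ‖x‖ < R then
        (j0 (κ * ‖x‖)) ^ m₁ / cst κ R m₁ - (j0 (κ * ‖x‖)) ^ m₂ / cst κ R m₂
      else 0)
    (f : E3 → ℝ)
    (hf : ∀ x : E3, f x = if ‖x‖ < R then LapR g x + κ ^ 2 * g x else 0) :
    ∀ x : E3, R < ‖x‖ → (∫ y in ball3 R, G3 κ x y * ((f y : ℝ) : ℂ)) = 0 := by
  intro x hx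
  set c₁ := cst κ R m₁ with hc₁d
  set c₂ := cst κ R m₂ with hc₂d
  let φ : ℝ → ℝ := fun r => j0 (κ * r) ^ m₁ / c₁ - j0 (κ * r) ^ m₂ / c₂
  have hjc : ContDiff ℝ 2 (fun r => j0 (κ * r)) := contDiff_j0.comp (by fun_prop)
  have hφ : ContDiff ℝ 2 φ := ((hjc.pow m₁).div_const c₁).sub ((hjc.pow m₂).div_const c₂)
  have hφ1 : ContDiff ℝ 1 (deriv φ) := by
    have h : ContDiff ℝ (1 + 1) φ := by simpa [one_add_one_eq_two] using hφ
    exact (contDiff_succ_iff_deriv.1 h).2.2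
  have hφ2 : Continuous (deriv (deriv φ)) := hφ1.continuous_deriv le_rfl
  have h1 : ∀ r, HasDerivAt φ (deriv φ r) r := fun r =>
    (hφ.differentiable (by norm_num) r).hasDerivAt
  have h2 : ∀ r, HasDerivAt (deriv φ) (deriv (deriv φ) r) r := fun r =>
    (hφ1.differentiable (by norm_num) r).hasDerivAt
  have hj0c : Continuous j0 := contDiff_j0.continuous
  have heven : ∀ r, φ (-r) = φ r := by
    intro r
    simp only [φ, j0_eq, mul_neg, Real.sinc_neg]
  have hd0 : deriv φ 0 = 0 := by
    have h := deriv_comp_neg φ 0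
    simp only [heven, neg_zero] at h
    linarith
  have hjR : j0 (κ * R) = 0 := by
    rw [j0_eq, Real.sinc_of_ne_zero (by positivity), hRzero, zero_div]
  have hφR : φ R = 0 := by
    simp only [φ, hjR]
    rw [zero_pow (by omega), zero_pow (by omega)]
    simp
  have hφR1 : deriv φ R = 0 := by
    have hj := (hjc.differentiable (by norm_num) R).hasDerivAt
    have := ((hj.pow m₁).div_const c₁).sub ((hj.pow m₂).div_const c₂)
    have h3 := HasDerivAt.unique (h1 R) this
    rw [h3, hjR, zero_pow (by omega), zero_pow (by omega)]
    simp
  have hint : ∫ r in (0:ℝ)..R, φ r * (r * Real.sinh (κ * r)) = 0 := by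
    have e : ∀ r, φ r * (r * Real.sinh (κ * r)) =
        κ / c₁ * (κ⁻¹ * (j0 (κ * r) ^ m₁ * (r * Real.sinh (κ * r)))) -
        κ / c₂ * (κ⁻¹ * (j0 (κ * r) ^ m₂ * (r * Real.sinh (κ * r)))) := by
      intro r
      simp only [φ]
      field_simp
    simp_rw [e]
    rw [intervalIntegral.integral_sub (Continuous.intervalIntegrable (by fun_prop) _ _)
      (Continuous.intervalIntegrable (by fun_prop) _ _), 
      intervalIntegral.integral_const_mul (κ / c₁), intervalIntegral.integral_const_mul (κ / c₂),
      ← cst_eq κ R hκ, ← cst_eq κ R hκ, ← hc₁d, ← hc₂d]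
    field_simp
    ring
  let F : ℝ → ℝ := fun r => deriv (deriv φ) r + 2 * dslope (deriv φ) 0 r + κ ^ 2 * φ r
  have hds : Continuous (dslope (deriv φ) 0) := by
    rw [← continuousOn_univ, continuousOn_dslope Filter.univ_mem]
    exact ⟨hφ1.continuous.continuousOn, (h2 0).differentiableAt⟩
  have hφc : Continuous φ := hφ.continuous
  have hFc : Continuous F := by fun_prop
  have hds' : ∀ r, r * dslope (deriv φ) 0 r = deriv φ r := by
    intro r
    have := sub_smul_dslope (deriv φ) 0 r
    simpa [hd0] using this
  have hFr : ∀ r, r * F r = r * deriv (deriv φ) r + 2 * deriv φ r + κ ^ 2 * (r * φ r) := by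
    intro r
    rw [← hds' r]
    simp only [F]
    ring
  obtain ⟨hs, hsh⟩ := final_1d κ R hRzero φ _ _ F h1 h2 hφ2 hFr hφR hφR1 hint
  rw [← main_int κ R hκ hR F hFc hs hsh x hx]
  have hm : MeasurableSet (ball3 R) := measurableSet_lt (by fun_prop) (by fun_prop)
  refine integral_congr_ae ?_
  have hne0 : ∀ᵐ y : E3 ∂(volume.restrict (ball3 R)), y ≠ 0 := by
    refine ae_restrict_of_ae ?_
    rw [ae_iff]
    simp
  filter_upwards [hne0, ae_restrict_mem hm] with y hy0 hy
  have hyR : ‖y‖ < R := hy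
  have hfy : f y = F ‖y‖ := by
    rw [hf y, if_pos hyR]
    have hw : g =ᶠ[nhds y] fun z => φ ‖z‖ := by
      have : {z : E3 | ‖z‖ < R} ∈ nhds y :=
        (isOpen_lt continuous_norm continuous_const).mem_nhds hyR
      filter_upwards [this] with z hz
      rw [hg z, if_pos hz]
    rw [lapR_radial φ _ _ h1 h2 g y hy0 hw, hw.eq_of_nhds]
    have hn : ‖y‖ ≠ 0 := by simpa using hy0
    simp only [F]
    rw [← hds' ‖y‖]
    field_simp
  rw [hfy]
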